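/- Let R be a commutative noetherian ring with unity, let a be an ideal of R, let M be an R-module, and let c = cd(a,R) = sup{ i ≥ 0 : H^i_a(R) ≠ 0 }. If Tor^R_i(R/a, M) is a finitely generated R-module for every 0 ≤ i ≤ c, then Tor^R_i(N, M) is a finitely generated R-module for every finitely generated R-module N with Supp_R(N) ⊆ V(a) and every i ≥ 0. -/

import Mathlib

open CategoryTheory

universe u

section ExtMapZero

variable {R : Type u} [CommRing R]

/-- Precomposition with `f : A ⟶ B` is zero on `Ext^n(-, Q)`. -/
def ExtMapZero {A B : ModuleCat.{u} R} (f : A ⟶ B) (n : ℕ) (Q : ModuleCat.{u} R) : Prop :=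
  ∀ x : Abelian.Ext B Q n, (Abelian.Ext.mk₀ f).comp x (zero_add n) = 0

open Abelian

lemma mk₀_comp_mk₀_comp {A B C Q : ModuleCat.{u} R} (g : A ⟶ B) (f : B ⟶ C) (n : ℕ)
    (x : Ext C Q n) :
    (Ext.mk₀ (g ≫ f)).comp x (zero_add n) =
      (Ext.mk₀ g).comp ((Ext.mk₀ f).comp x (zero_add n)) (zero_add n) := by
  rw [Ext.mk₀_comp_mk₀_assoc]

lemma ExtMapZero.comp_left {A B C Q : ModuleCat.{u} R} {f : B ⟶ C} {n : ℕ}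
    (hf : ExtMapZero f n Q) (g : A ⟶ B) : ExtMapZero (g ≫ f) n Q := fun x ↦ by
  rw [mk₀_comp_mk₀_comp, hf, Ext.comp_zero]

lemma ExtMapZero.comp_right {A B C Q : ModuleCat.{u} R} {g : A ⟶ B} {n : ℕ}
    (hg : ExtMapZero g n Q) (f : B ⟶ C) : ExtMapZero (g ≫ f) n Q := fun x ↦ by
  rw [mk₀_comp_mk₀_comp, hg]

lemma ExtMapZero.of_projective {A B Q : ModuleCat.{u} R} [Projective A] (f : A ⟶ B) {n : ℕ}
    (hn : 0 < n) : ExtMapZero f n Q := by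
  obtain ⟨n, rfl⟩ := Nat.exists_eq_add_of_lt hn
  intro x
  exact Ext.eq_zero_of_projective (n := 0 + n) _

lemma mk₀_τ₃_comp_extClass_comp {S₁ S₂ : ShortComplex (ModuleCat.{u} R)}
    (h₁ : S₁.ShortExact) (h₂ : S₂.ShortExact) (φ : S₁ ⟶ S₂) {Q : ModuleCat.{u} R} {m n : ℕ}
    (hmn : 1 + m = n) (y : Ext S₂.X₁ Q m) :
    (Ext.mk₀ φ.τ₃).comp (h₂.extClass.comp y hmn) (zero_add n) =
      h₁.extClass.comp ((Ext.mk₀ φ.τ₁).comp y (zero_add m)) hmn := by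
  rw [← Ext.comp_assoc _ _ _ (zero_add 1) hmn (by lia),
    ← ShortComplex.ShortExact.extClass_naturality h₁ h₂ φ,
    Ext.comp_assoc _ _ _ (add_zero 1) (zero_add m) (by lia)]

lemma ExtMapZero.pi_finite {A B Q : ModuleCat.{u} R} {f : A ⟶ B} {n : ℕ}
    (hf : ExtMapZero f n Q) (k : ℕ) : ExtMapZero f n (ModuleCat.of R (Fin k → Q)) := by
  intro x
  have hid : 𝟙 (ModuleCat.of R (Fin k → Q)) = ∑ j, ModuleCat.ofHom (LinearMap.proj j) ≫
      ModuleCat.ofHom (LinearMap.single R (fun _ ↦ (Q : Type u)) j) := by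
    refine ModuleCat.hom_ext (LinearMap.ext fun v ↦ ?_)
    simp only [ModuleCat.hom_id, LinearMap.id_apply, ModuleCat.hom_sum, LinearMap.sum_apply,
      ModuleCat.hom_comp, ModuleCat.hom_ofHom, LinearMap.comp_apply, LinearMap.proj_apply]
    exact (Finset.univ_sum_single (M := fun _ ↦ (Q : Type u)) v).symm
  rw [← Ext.comp_mk₀_id ((Ext.mk₀ f).comp x (zero_add n)), hid, Ext.mk₀_sum, Ext.comp_sum]
  refine Finset.sum_eq_zero fun j _ ↦ ?_
  rw [← Ext.mk₀_comp_mk₀, ← Ext.comp_assoc _ _ _ (add_zero n) (add_zero 0) (by lia),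
    Ext.comp_assoc _ _ _ (zero_add n) (add_zero n) (by lia), hf, Ext.zero_comp]

/-- Descending induction on the cohomological degree. -/
lemma ExtMapZero.comp_of_succ [IsNoetherianRing R] {A B C : ModuleCat.{u} R} {g : A ⟶ B}
    {f : B ⟶ C} {n : ℕ}
    (hf : ∀ Q : ModuleCat.{u} R, Module.Finite R Q → ExtMapZero f (n + 1) Q)
    (hg : ExtMapZero g n (ModuleCat.of R R))
    (Q : ModuleCat.{u} R) (hQ : Module.Finite R Q) : ExtMapZero (g ≫ f) n Q := by
  intro x
  obtain ⟨k, p, hp⟩ := Module.Finite.exists_fin' R Q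
  have hS := LinearMap.shortExact_shortComplexKer hp
  have h1 := hf (ModuleCat.of R (LinearMap.ker p)) inferInstance
    (x.comp hS.extClass (rfl : n + 1 = n + 1))
  rw [← Ext.comp_assoc _ _ _ (zero_add n) rfl (by lia)] at h1
  obtain ⟨y, hy⟩ := Ext.covariant_sequence_exact₃ _ hS _ rfl h1
  rw [mk₀_comp_mk₀_comp, ← hy, ← Ext.comp_assoc _ _ _ (zero_add n) (add_zero n) (by lia)]
  have := hg.pi_finite k y
  rw [show (Ext.mk₀ g).comp y (zero_add n) = 0 from this, Ext.zero_comp]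

/-- The projection `R ⧸ J' ⟶ R ⧸ J` for ideals `J' ≤ J`. -/
abbrev quotientProj {J' J : Ideal R} (h : J' ≤ J) :
    ModuleCat.of R (R ⧸ J') ⟶ ModuleCat.of R (R ⧸ J) :=
  ModuleCat.ofHom (Submodule.mapQ J' J LinearMap.id h)

lemma quotientProj_comp {J₂ J₁ J : Ideal R} (h : J₂ ≤ J₁) (h' : J₁ ≤ J) :
    quotientProj h ≫ quotientProj h' = quotientProj (h.trans h') := by
  ext
  rfl

/-- The complex `0 → R ⧸ (I : y) → R ⧸ I → R ⧸ (I + (y)) → 0` induced by multiplication by `y`. -/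
abbrev colonShortComplex (I : Ideal R) (y : R) : ShortComplex (ModuleCat.{u} R) where
  X₁ := ModuleCat.of R (R ⧸ Submodule.comap (LinearMap.mulLeft R y) I)
  X₂ := ModuleCat.of R (R ⧸ I)
  X₃ := ModuleCat.of R (R ⧸ (I ⊔ Ideal.span {y}))
  f := ModuleCat.ofHom (Submodule.mapQ _ I (LinearMap.mulLeft R y) le_rfl)
  g := quotientProj le_sup_left
  zero := by
    refine ModuleCat.hom_ext (LinearMap.ext fun v ↦ ?_)
    obtain ⟨r, rfl⟩ := Submodule.Quotient.mk_surjective _ v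
    exact (Submodule.Quotient.mk_eq_zero _).2 (Ideal.mem_sup_right
      (Ideal.mul_mem_right _ _ (Ideal.mem_span_singleton_self y)))

lemma shortExact_colonShortComplex (I : Ideal R) (y : R) : (colonShortComplex I y).ShortExact := by
  refine ModuleCat.shortComplex_shortExact _ ?_ ?_ ?_
  · intro v
    obtain ⟨r, rfl⟩ := Submodule.Quotient.mk_surjective _ v
    constructor
    · intro h
      obtain ⟨a, ha, b, hb, hab⟩ :=
        Submodule.mem_sup.1 ((Submodule.Quotient.mk_eq_zero _).1 h)
      obtain ⟨c, rfl⟩ := Ideal.mem_span_singleton'.1 hb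
      refine ⟨Submodule.Quotient.mk c, (Submodule.Quotient.eq _).2 ?_⟩
      change y * c - r ∈ I
      rw [show y * c - r = -a by rw [← show a + c * y = r from hab]; ring]
      exact I.neg_mem ha
    · rintro ⟨w, hw⟩
      rw [← hw]
      exact ConcreteCategory.congr_hom (colonShortComplex I y).zero w
  · refine (injective_iff_map_eq_zero _).2 fun v hv ↦ ?_
    obtain ⟨r, rfl⟩ := Submodule.Quotient.mk_surjective _ v
    exact (Submodule.Quotient.mk_eq_zero _).2 ((Submodule.Quotient.mk_eq_zero I).1 hv)
  · intro v
    obtain ⟨r, rfl⟩ := Submodule.Quotient.mk_surjective _ v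
    exact ⟨Submodule.Quotient.mk r, rfl⟩

/-- The morphism of short complexes given by multiplication by `z` on the left. -/
abbrev colonShortComplexMap {I' I : Ideal R} (h : I' ≤ I) (y z : R) :
    colonShortComplex I' (y * z) ⟶ colonShortComplex I y where
  τ₁ := ModuleCat.ofHom (Submodule.mapQ _ _ (LinearMap.mulLeft R z) fun r hr ↦ by
    simpa [mul_assoc] using h hr)
  τ₂ := quotientProj h
  τ₃ := quotientProj (sup_le_sup h
    (Ideal.span_singleton_le_span_singleton.2 (dvd_mul_right y z)))
  comm₁₂ := by
    refine ModuleCat.hom_ext (LinearMap.ext fun v ↦ ?_)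
    obtain ⟨r, rfl⟩ := Submodule.Quotient.mk_surjective _ v
    exact congr_arg (Submodule.Quotient.mk (p := I)) (mul_assoc y z r).symm
  comm₂₃ := by
    refine ModuleCat.hom_ext (LinearMap.ext fun v ↦ ?_)
    obtain ⟨r, rfl⟩ := Submodule.Quotient.mk_surjective _ v
    rfl

lemma exists_extMapZero_quotientProj_sup_span [IsNoetherianRing R] (x : R) (t d : ℕ)
    {I₂ I₁ J : Ideal R} (h₂ : I₂ ≤ I₁) (h₁ : I₁ ≤ J) (hx : x ^ t ∈ J)
    (H₂ : ∀ n, d < n → ∀ Q, ExtMapZero (quotientProj h₂) n Q)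
    (H₁ : ∀ n, d < n → ∀ Q, ExtMapZero (quotientProj h₁) n Q) :
    ∃ (e : ℕ) (h : I₂ ⊔ Ideal.span {x ^ t * x ^ e} ≤ J),
      ∀ n, d + 1 < n → ∀ Q, ExtMapZero (quotientProj h) n Q := by
  obtain ⟨e, he⟩ : ∃ e : ℕ, ∀ (m : ℕ) (r : R), x ^ m * r ∈ I₂ → x ^ e * r ∈ I₂ := by
    let C : ℕ →o Ideal R := ⟨fun k ↦ Submodule.comap (LinearMap.mulLeft R (x ^ k)) I₂,
      monotone_nat_of_le_succ fun k r hr ↦ by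
        change x ^ (k + 1) * r ∈ I₂
        rw [pow_succ', mul_assoc]
        exact I₂.mul_mem_left _ hr⟩
    obtain ⟨e, he⟩ := monotone_stabilizes_iff_noetherian.2 ‹IsNoetherianRing R› C
    refine ⟨e, fun m r hr ↦ ?_⟩
    have h1 : r ∈ C (max e m) := C.monotone (le_max_right e m) hr
    rw [← he _ (le_max_left e m)] at h1
    exact h1
  have hJ : I₁ ⊔ Ideal.span {x ^ t} ≤ J :=
    sup_le h₁ ((Ideal.span_singleton_le_iff_mem _).2 hx)
  have hJ₂ : I₂ ⊔ Ideal.span {x ^ t * x ^ e} ≤ I₁ ⊔ Ideal.span {x ^ t} := sup_le_sup h₂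
    (Ideal.span_singleton_le_span_singleton.2 (dvd_mul_right _ _))
  refine ⟨e, hJ₂.trans hJ, fun n hn Q ξ ↦ ?_⟩
  obtain ⟨m, rfl⟩ : ∃ m, 1 + m = n := ⟨n - 1, by lia⟩
  have h0 : (Ext.mk₀ (colonShortComplex I₁ (x ^ t)).g).comp
      ((Ext.mk₀ (quotientProj hJ)).comp ξ (zero_add _)) (zero_add _) = 0 := by
    rw [← mk₀_comp_mk₀_comp, quotientProj_comp]
    exact H₁ _ (by lia) Q ξ
  obtain ⟨ζ, hζ⟩ := Ext.contravariant_sequence_exact₃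
    (shortExact_colonShortComplex I₁ (x ^ t)) Q _ h0 rfl
  rw [← quotientProj_comp hJ₂ hJ, mk₀_comp_mk₀_comp, ← hζ]
  have hnat := mk₀_τ₃_comp_extClass_comp (shortExact_colonShortComplex I₂ (x ^ t * x ^ e))
    (shortExact_colonShortComplex I₁ (x ^ t)) (colonShortComplexMap h₂ (x ^ t) (x ^ e)) rfl ζ
  refine hnat.trans ?_
  have hfac : (colonShortComplexMap h₂ (x ^ t) (x ^ e)).τ₁ =
      ModuleCat.ofHom (Submodule.mapQ _ I₂ (LinearMap.mulLeft R (x ^ e)) fun r hr ↦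
        he (t + e) r (by rw [pow_add]; exact hr)) ≫ quotientProj h₂ ≫
        quotientProj (J := Submodule.comap (LinearMap.mulLeft R (x ^ t)) I₁)
          fun r hr ↦ I₁.mul_mem_left _ hr := by
    refine ModuleCat.hom_ext (LinearMap.ext fun v ↦ ?_)
    obtain ⟨r, rfl⟩ := Submodule.Quotient.mk_surjective _ v
    rfl
  have hz : ExtMapZero (colonShortComplexMap h₂ (x ^ t) (x ^ e)).τ₁ m Q := by
    rw [hfac]
    exact ((H₂ m (by lia) Q).comp_right _).comp_left _
  rw [hz ζ, Ext.comp_zero]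

lemma exists_bound_extMapZero [IsNoetherianRing R] (b : Ideal R) :
    ∃ d : ℕ, ∀ J : Ideal R, b ≤ J.radical → ∃ (J' : Ideal R) (h : J' ≤ J), b ≤ J'.radical ∧
      ∀ n, d < n → ∀ Q, ExtMapZero (quotientProj h) n Q := by
  obtain ⟨s, rfl⟩ := IsNoetherian.noetherian b
  classical
  induction s using Finset.induction_on with
  | empty =>
    refine ⟨0, fun J _ ↦ ⟨⊥, bot_le, by simp, fun n hn Q ↦ ?_⟩⟩
    have : Module.Projective R (R ⧸ (⊥ : Ideal R)) :=
      Module.Projective.of_equiv (Submodule.quotEquivOfEqBot (⊥ : Ideal R) rfl).symm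
    exact .of_projective _ hn
  | insert x s _ ih =>
    obtain ⟨d, hd⟩ := ih
    refine ⟨d + 1, fun J hJ ↦ ?_⟩
    rw [Finset.coe_insert, Submodule.span_insert] at hJ
    obtain ⟨I₁, h₁, hr₁, H₁⟩ := hd J (le_sup_right.trans hJ)
    obtain ⟨I₂, h₂, hr₂, H₂⟩ := hd I₁ hr₁
    obtain ⟨t, ht⟩ := hJ (Ideal.mem_sup_left (Ideal.mem_span_singleton_self x))
    obtain ⟨k, h, H⟩ := exists_extMapZero_quotientProj_sup_span x t d h₂ h₁ ht H₂ H₁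
    refine ⟨_, h, ?_, H⟩
    rw [Finset.coe_insert, Submodule.span_insert]
    refine sup_le ?_ (hr₂.trans (Ideal.radical_mono le_sup_left))
    exact (Ideal.span_singleton_le_iff_mem _).2
      ⟨t + k, Ideal.mem_sup_right (by rw [pow_add]; exact Ideal.mem_span_singleton_self _)⟩

lemma exists_bound_extMapZero_pow [IsNoetherianRing R] (a : Ideal R) :
    ∃ d : ℕ, ∀ t : ℕ, ∃ (s : ℕ) (h : t ≤ s), ∀ n, d < n → ∀ Q,
      ExtMapZero (quotientProj (Ideal.pow_le_pow_right h : a ^ s ≤ a ^ t)) n Q := by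
  obtain ⟨d, hd⟩ := exists_bound_extMapZero a
  refine ⟨d, fun t ↦ ?_⟩
  obtain ⟨J', h, hr, H⟩ := hd (a ^ t) fun r hr ↦ ⟨t, Ideal.pow_mem_pow hr t⟩
  obtain ⟨k, hk⟩ := Ideal.exists_pow_le_of_le_radical_of_fg hr (IsNoetherian.noetherian a)
  refine ⟨max t k, le_max_left t k, fun n hn Q ↦ ?_⟩
  have hk' : a ^ max t k ≤ J' := (Ideal.pow_le_pow_right (le_max_right t k)).trans hk
  have := (H n hn Q).comp_left (quotientProj hk')
  rwa [quotientProj_comp] at this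

end ExtMapZero

section Rep

variable {R : Type u} [CommRing R]

/-- A cocycle `f` of a chain complex in the opposite category of modules represents the
cohomology class `y`. -/
def RepresentsClass (K : ChainComplex (ModuleCat.{u} R)ᵒᵖ ℕ) (n : ℕ) (f : (K.X n).unop)
    (y : (K.homology n).unop) : Prop :=
  (K.iCycles n).unop f = (K.homologyπ n).unop y

variable {K L : ChainComplex (ModuleCat.{u} R)ᵒᵖ ℕ} {n : ℕ}

lemma exists_representsClass (y : (K.homology n).unop) : ∃ f, RepresentsClass K n f y :=
  (ModuleCat.epi_iff_surjective (K.iCycles n).unop).1 inferInstance _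

lemma RepresentsClass.d_eq_zero {f : (K.X n).unop} {y : (K.homology n).unop}
    (h : RepresentsClass K n f y) : (K.d (n + 1) n).unop f = 0 := by
  have h1 := congr_arg (K.toCycles (n + 1) n).unop h
  rw [← ConcreteCategory.comp_apply, ← ConcreteCategory.comp_apply, ← unop_comp, ← unop_comp,
    K.toCycles_i, K.toCycles_comp_homologyπ] at h1
  exact h1

lemma RepresentsClass.map (φ : K ⟶ L) {f : (L.X n).unop} {y : (L.homology n).unop}
    (h : RepresentsClass L n f y) :
    RepresentsClass K n ((φ.f n).unop f) ((HomologicalComplex.homologyMap φ n).unop y) := by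
  have h1 := congr_arg (HomologicalComplex.cyclesMap φ n).unop h
  rw [← ConcreteCategory.comp_apply, ← ConcreteCategory.comp_apply, ← unop_comp, ← unop_comp,
    HomologicalComplex.cyclesMap_i, ← HomologicalComplex.homologyπ_naturality, unop_comp,
    unop_comp] at h1
  exact h1

lemma exists_representsClass_of_d_eq_zero {f : (K.X n).unop}
    (h : (K.d (n + 1) n).unop f = 0) : ∃ y, RepresentsClass K n f y := by
  have hS : (ShortComplex.mk (K.toCycles (n + 1) n) (K.homologyπ n)
      (K.toCycles_comp_homologyπ _ _)).Exact :=
    ShortComplex.exact_of_g_is_cokernel _ (K.homologyIsCokernel (n + 1) n (by simp))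
  obtain ⟨y, hy⟩ := (ShortComplex.moduleCat_exact_iff _).1 hS.unop ((K.iCycles n).unop f) (by
    change (K.toCycles (n + 1) n).unop _ = 0
    rw [← ConcreteCategory.comp_apply, ← unop_comp, K.toCycles_i, h])
  exact ⟨y, hy.symm⟩

lemma RepresentsClass.eq_zero_iff {p : ℕ} {f : (K.X (p + 1)).unop}
    {y : (K.homology (p + 1)).unop} (h : RepresentsClass K (p + 1) f y) :
    y = 0 ↔ ∃ g, (K.d (p + 1) p).unop g = f := by
  have hinj : Function.Injective (K.homologyπ (p + 1)).unop :=
    (ModuleCat.mono_iff_injective _).1 inferInstance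
  rw [← map_eq_zero_iff _ hinj, ← h]
  have hS : (ShortComplex.mk (K.iCycles (p + 1)) (K.d (p + 1) p) (by simp)).Exact :=
    ShortComplex.exact_of_f_is_kernel _ (K.cyclesIsKernel (p + 1) p (by simp))
  refine ⟨fun h0 ↦ (ShortComplex.moduleCat_exact_iff _).1 hS.unop f h0, ?_⟩
  rintro ⟨g, rfl⟩
  exact ConcreteCategory.congr_hom (congr_arg Quiver.Hom.unop (K.iCycles_d (p + 1) p)) g

end Rep

section ExtRel

variable {R : Type u} [CommRing R] {X X' Y : ModuleCat.{u} R}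

/-- The complex computing `Ext(X, Y)` from a projective resolution of `X`, viewed in the opposite
category. -/
noncomputable abbrev opYonedaComplex (P : ProjectiveResolution X) (Y : ModuleCat.{u} R) :
    ChainComplex (ModuleCat.{u} R)ᵒᵖ ℕ :=
  (((linearYoneda R (ModuleCat.{u} R)).obj Y).rightOp.mapHomologicalComplex _).obj P.complex

/-- Two elements of the two models of `Ext^n(X, Y)` are represented by a common cocycle. -/
def ExtRel (P : ProjectiveResolution X) (n : ℕ) (x : Abelian.Ext X Y n)
    (y : ((Ext R (ModuleCat.{u} R) n).obj (Opposite.op X)).obj Y) : Prop :=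
  ∃ (f : P.complex.X n ⟶ Y) (hf : P.complex.d (n + 1) n ≫ f = 0),
    P.extMk f (n + 1) rfl hf = x ∧ RepresentsClass (opYonedaComplex P Y) n f
      ((P.isoLeftDerivedObj ((linearYoneda R (ModuleCat.{u} R)).obj Y).rightOp n).inv.unop y)

lemma exists_extRel_left (P : ProjectiveResolution X) (n : ℕ)
    (y : ((Ext R (ModuleCat.{u} R) n).obj (Opposite.op X)).obj Y) :
    ∃ x, ExtRel P n x y := by
  obtain ⟨f, hf⟩ := exists_representsClass (K := opYonedaComplex P Y)
      ((P.isoLeftDerivedObj ((linearYoneda R (ModuleCat.{u} R)).obj Y).rightOp n).inv.unop y)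
  exact ⟨_, f, hf.d_eq_zero, rfl, hf⟩

lemma exists_extRel_right (P : ProjectiveResolution X) (n : ℕ) (x : Abelian.Ext X Y n) :
    ∃ y, ExtRel P n x y := by
  obtain ⟨f, hf, rfl⟩ := P.extMk_surjective x (n + 1) rfl
  obtain ⟨y, hy⟩ := exists_representsClass_of_d_eq_zero (K := opYonedaComplex P Y) (f := f) hf
  refine ⟨(P.isoLeftDerivedObj
    ((linearYoneda R (ModuleCat.{u} R)).obj Y).rightOp n).hom.unop y, f, hf, rfl, ?_⟩
  have h := ConcreteCategory.congr_hom (congr_arg Quiver.Hom.unop (P.isoLeftDerivedObj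
    ((linearYoneda R (ModuleCat.{u} R)).obj Y).rightOp n).inv_hom_id) y
  exact Eq.mp (congr_arg (RepresentsClass (opYonedaComplex P Y) n f) h.symm) hy

lemma ExtRel.eq_zero_iff {P : ProjectiveResolution X} {n : ℕ} (hn : 0 < n)
    {x : Abelian.Ext X Y n} {y : ((Ext R (ModuleCat.{u} R) n).obj (Opposite.op X)).obj Y}
    (h : ExtRel P n x y) : x = 0 ↔ y = 0 := by
  obtain ⟨f, hf, rfl, hy⟩ := h
  obtain ⟨p, rfl⟩ : ∃ p, n = p + 1 := ⟨n - 1, by lia⟩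
  have hinj : Function.Injective (P.isoLeftDerivedObj
      ((linearYoneda R (ModuleCat.{u} R)).obj Y).rightOp (p + 1)).inv.unop :=
    (ModuleCat.mono_iff_injective _).1 inferInstance
  rw [P.extMk_eq_zero_iff _ _ _ _ p rfl]
  exact hy.eq_zero_iff.symm.trans (map_eq_zero_iff _ hinj)

lemma ExtRel.map {P : ProjectiveResolution X} {P' : ProjectiveResolution X'} {g : X' ⟶ X}
    {n : ℕ} {x : Abelian.Ext X Y n}
    {y : ((Ext R (ModuleCat.{u} R) n).obj (Opposite.op X)).obj Y} (h : ExtRel P n x y) :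
    ExtRel P' n ((Abelian.Ext.mk₀ g).comp x (zero_add n))
      (((Ext R (ModuleCat.{u} R) n).map g.op).app Y y) := by
  obtain ⟨f, hf, rfl, hy⟩ := h
  let φ : ProjectiveResolution.Hom P' P g :=
    ⟨ProjectiveResolution.lift g P' P, by
      have h0 := HomologicalComplex.congr_hom (ProjectiveResolution.lift_commutes g P' P) 0
      rwa [HomologicalComplex.comp_f, HomologicalComplex.comp_f,
        ChainComplex.single₀_map_f_zero] at h0⟩
  refine ⟨φ.hom.f n ≫ f, by simp [← φ.hom.comm_assoc, hf],
    (P.mk₀_comp_extMk f (n + 1) rfl hf φ).symm, ?_⟩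
  have h1 := hy.map ((((linearYoneda R (ModuleCat.{u} R)).obj Y).rightOp.mapHomologicalComplex
    _).map φ.hom)
  have h2 := ProjectiveResolution.isoLeftDerivedObj_inv_naturality g P' P φ.hom
    φ.hom_f_zero_comp_π_f_zero
    ((linearYoneda R (ModuleCat.{u} R)).obj Y).rightOp n
  have h3 := ConcreteCategory.congr_hom (congr_arg Quiver.Hom.unop h2) y
  exact Eq.mp (congr_arg (RepresentsClass (opYonedaComplex P' Y) n (φ.hom.f n ≫ f)) h3.symm) h1
end ExtRel

section LocalCohomology

open Limits Opposite

variable {R : Type u} [CommRing R] (a : Ideal R) (i : ℕ) (Y : ModuleCat.{u} R)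

/-- The system `t ↦ Ext^i(R ⧸ a ^ t, Y)` whose colimit is the `i`-th local cohomology of `Y`. -/
noncomputable abbrev extPowersDiagram : ℕᵒᵖᵒᵖ ⥤ ModuleCat.{u} R :=
  localCohomology.diagram (localCohomology.idealPowersDiagram a) i ⋙
    (evaluation (ModuleCat.{u} R) (ModuleCat.{u} R)).obj Y

/-- The local cohomology of `Y` is the colimit of `extPowersDiagram a i Y`. -/
lemma exists_isColimit_extPowersDiagram :
    ∃ D : Cocone (extPowersDiagram a i Y),
      D.pt = (localCohomology a i).obj Y ∧ Nonempty (IsColimit D) :=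
  ⟨_, rfl, ⟨isColimitOfPreserves ((evaluation (ModuleCat.{u} R) (ModuleCat.{u} R)).obj Y)
    (colimit.isColimit (localCohomology.diagram (localCohomology.idealPowersDiagram a) i))⟩⟩

lemma subsingleton_localCohomology_iff :
    Subsingleton ((localCohomology a i).obj Y) ↔
      ∀ (t : ℕ) (y : ((Ext R (ModuleCat.{u} R) i).obj (op (ModuleCat.of R (R ⧸ a ^ t)))).obj Y),
        ∃ (s : ℕ) (h : t ≤ s), ((Ext R (ModuleCat.{u} R) i).map
          (quotientProj (Ideal.pow_le_pow_right h : a ^ s ≤ a ^ t)).op).app Y y = 0 := by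
  have : PreservesFilteredColimitsOfSize.{0, 0} (forget (ModuleCat.{u} R)) :=
    preservesFilteredColimitsOfSize_shrink.{0, u, 0, u} _
  obtain ⟨D, hD, ⟨hc⟩⟩ := exists_isColimit_extPowersDiagram a i Y
  rw [← hD]
  constructor
  · intro _ t y
    obtain ⟨k, f, g, hfg⟩ := Concrete.isColimit_exists_of_rep_eq (extPowersDiagram a i Y) hc
      (i := op (op t)) (j := op (op t)) y 0 (Subsingleton.elim (α := D.pt) _ _)
    rw [map_zero] at hfg
    exact ⟨k.unop.unop, f.unop.unop.le, hfg⟩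
  · intro H
    refine subsingleton_of_forall_eq 0 fun x ↦ ?_
    obtain ⟨j, y, rfl⟩ := Concrete.isColimit_exists_rep (extPowersDiagram a i Y) hc x
    obtain ⟨s, h, hs⟩ := H j.unop.unop y
    let w : j ⟶ op (op s) := (homOfLE h).op.op
    have h1 := ConcreteCategory.congr_hom (D.w w) y
    have h2 : (extPowersDiagram a i Y).map w y = 0 := hs
    rw [← h1]
    exact (congr_arg (D.ι.app (op (op s))) h2).trans (map_zero _)

lemma exists_extMapZero_of_subsingleton [IsNoetherianRing R] {a : Ideal R} {i : ℕ} (hi : 0 < i)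
    {Y : ModuleCat.{u} R} [Module.Finite R Y]
    (h : Subsingleton ((localCohomology a i).obj Y)) (t : ℕ) :
    ∃ (s : ℕ) (h : t ≤ s),
      ExtMapZero (quotientProj (Ideal.pow_le_pow_right h : a ^ s ≤ a ^ t)) i Y := by
  rw [subsingleton_localCohomology_iff] at h
  let P (t : ℕ) := projectiveResolution (ModuleCat.of R (R ⧸ a ^ t))
  have key (x : Abelian.Ext (ModuleCat.of R (R ⧸ a ^ t)) Y i) : ∃ (s : ℕ) (h : t ≤ s),
      (Abelian.Ext.mk₀ (quotientProj (Ideal.pow_le_pow_right h : a ^ s ≤ a ^ t))).comp x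
        (zero_add i) = 0 := by
    obtain ⟨y, hy⟩ := exists_extRel_right (P t) i x
    obtain ⟨s, hs, h0⟩ := h t y
    exact ⟨s, hs, (ExtRel.eq_zero_iff hi (hy.map (P' := P s))).2 h0⟩
  choose s hs h0 using key
  obtain ⟨G, hG⟩ : (⊤ : Submodule R (Abelian.Ext (ModuleCat.of R (R ⧸ a ^ t)) Y i)).FG :=
    Module.Finite.fg_top
  refine ⟨max t (G.sup s), le_max_left _ _, fun x ↦ ?_⟩
  have hle : (⊤ : Submodule R (Abelian.Ext (ModuleCat.of R (R ⧸ a ^ t)) Y i)) ≤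
      LinearMap.ker (Abelian.Ext.precompOfLinear (Abelian.Ext.mk₀ (quotientProj
        (Ideal.pow_le_pow_right (le_max_left t (G.sup s)) : a ^ max t (G.sup s) ≤ a ^ t)))
        R Y (zero_add i)) := by
    rw [← hG, Submodule.span_le]
    intro x hx
    have hx' : s x ≤ max t (G.sup s) := (Finset.le_sup hx).trans (le_max_right _ _)
    change (Abelian.Ext.mk₀ _).comp x (zero_add i) = 0
    rw [← quotientProj_comp (Ideal.pow_le_pow_right hx') (Ideal.pow_le_pow_right (hs x)),
      mk₀_comp_mk₀_comp, h0, Abelian.Ext.comp_zero]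
  exact hle (Submodule.mem_top (x := x))

lemma bddAbove_nontrivial_localCohomology [IsNoetherianRing R] (a : Ideal R) :
    BddAbove {i : ℕ | Nontrivial ((localCohomology a i).obj (ModuleCat.of R R))} := by
  obtain ⟨d, hd⟩ := exists_bound_extMapZero_pow a
  refine ⟨d, fun i hi ↦ ?_⟩
  by_contra! hlt
  refine not_subsingleton_iff_nontrivial.2 hi ?_
  rw [subsingleton_localCohomology_iff]
  intro t y
  obtain ⟨s, hs, h⟩ := hd t
  obtain ⟨x, hx⟩ := exists_extRel_left
    (projectiveResolution (ModuleCat.of R (R ⧸ a ^ t))) i y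
  exact ⟨s, hs, (ExtRel.eq_zero_iff (by lia) (hx.map
    (P' := projectiveResolution (ModuleCat.of R (R ⧸ a ^ s))))).1 (h i hlt _ x)⟩

/-- Above the cohomological dimension, the transition maps of the system
`t ↦ Ext^i(R ⧸ a ^ t, Q)` are eventually zero, uniformly in the finite module `Q`. -/
lemma exists_extMapZero_of_sSup_lt [IsNoetherianRing R] (a : Ideal R) {i : ℕ}
    (hi : sSup {i : ℕ | Nontrivial ((localCohomology a i).obj (ModuleCat.of R R))} < i) (t : ℕ) :
    ∃ (s : ℕ) (h : t ≤ s), ∀ Q : ModuleCat.{u} R, Module.Finite R Q →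
      ExtMapZero (quotientProj (Ideal.pow_le_pow_right h : a ^ s ≤ a ^ t)) i Q := by
  obtain ⟨d, hd⟩ := exists_bound_extMapZero_pow a
  have hdesc (k : ℕ) : ∀ i, sSup {i : ℕ | Nontrivial ((localCohomology a i).obj
      (ModuleCat.of R R))} < i → d < i + k → ∀ t : ℕ, ∃ (s : ℕ) (h : t ≤ s),
      ∀ Q : ModuleCat.{u} R, Module.Finite R Q →
      ExtMapZero (quotientProj (Ideal.pow_le_pow_right h : a ^ s ≤ a ^ t)) i Q := by
    induction k with
    | zero =>
      intro i _ hk t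
      obtain ⟨s, hs, h⟩ := hd t
      exact ⟨s, hs, fun Q _ ↦ h i hk Q⟩
    | succ k ih =>
      intro i hi hk t
      obtain ⟨s, hs, h⟩ := ih (i + 1) (by lia) (by lia) t
      have hsub : Subsingleton ((localCohomology a i).obj (ModuleCat.of R R)) :=
        not_nontrivial_iff_subsingleton.1 fun hn ↦
          (le_csSup (bddAbove_nontrivial_localCohomology a) hn).not_gt hi
      obtain ⟨r, hr, h'⟩ := exists_extMapZero_of_subsingleton (by lia) hsub s
      refine ⟨r, hs.trans hr, fun Q hQ ↦ ?_⟩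
      have := ExtMapZero.comp_of_succ h h' Q hQ
      rwa [quotientProj_comp] at this
  exact hdesc (d + 1) i hi (by lia) t

end LocalCohomology

section TensorHomology

open MonoidalCategory

variable {R : Type u} [CommRing R] (P : ChainComplex (ModuleCat.{u} R) ℕ)

/-- The functor sending a module `N` to the complex `N ⊗ P`. -/
noncomputable abbrev tensorComplex : ModuleCat.{u} R ⥤ ChainComplex (ModuleCat.{u} R) ℕ where
  obj N := (((tensoringLeft (ModuleCat.{u} R)).obj N).mapHomologicalComplex _).obj P
  map f := (NatTrans.mapHomologicalComplex ((tensoringLeft (ModuleCat.{u} R)).map f) _).app P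
  map_id N := by ext1 i; exact id_whiskerRight N (P.X i)
  map_comp f g := by ext1 i; exact comp_whiskerRight f g (P.X i)

instance : (tensorComplex P).PreservesZeroMorphisms where
  map_zero _ _ := by ext1 i; exact MonoidalPreadditive.zero_whiskerRight

/-- The functor sending a module `N` to the homology of `N ⊗ P` in degree `n`. -/
noncomputable abbrev tensorHomology (n : ℕ) : ModuleCat.{u} R ⥤ ModuleCat.{u} R :=
  tensorComplex P ⋙ HomologicalComplex.homologyFunctor _ _ n

variable {P}

lemma shortExact_map_tensorComplex [∀ n, Module.Flat R (P.X n)]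
    {S : ShortComplex (ModuleCat.{u} R)} (hS : S.ShortExact) :
    (S.map (tensorComplex P)).ShortExact := by
  refine HomologicalComplex.shortExact_of_degreewise_shortExact _ fun i ↦ ?_
  have hmono := hS.mono_f
  have hepi := hS.epi_g
  refine .mk' (Module.Flat.rTensor_shortComplex_exact (P.X i) S hS.exact) ?_ ?_
  · refine (ModuleCat.mono_iff_injective _).2 ?_
    exact Module.Flat.rTensor_preserves_injective_linearMap S.f.hom
      ((ModuleCat.mono_iff_injective _).1 hmono)
  · refine (ModuleCat.epi_iff_surjective _).2 ?_
    exact LinearMap.rTensor_surjective (P.X i) ((ModuleCat.epi_iff_surjective S.g).1 hepi)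

lemma isZero_tensorHomology_of_flat (hP : ∀ n, P.ExactAt (n + 1)) (F : ModuleCat.{u} R)
    [Module.Flat R F] (n : ℕ) : Limits.IsZero ((tensorHomology P (n + 1)).obj F) := by
  refine (HomologicalComplex.exactAt_iff_isZero_homology _ _).1 ?_
  have h : ((P.sc (n + 1)).map (tensorLeft F)).Exact :=
    Module.Flat.lTensor_shortComplex_exact F _ ((P.exactAt_iff _).1 (hP n))
  exact h

/-- Vanishing of all maps induced on `Ext` implies vanishing of the map induced on `Tor`. -/
lemma tensorHomology_map_eq_zero [IsNoetherianRing R] [∀ n, Module.Flat R (P.X n)]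
    (hP : ∀ n, P.ExactAt (n + 1)) (n : ℕ) {A B : ModuleCat.{u} R} [Module.Finite R A]
    [Module.Finite R B] (f : A ⟶ B)
    (hf : ∀ Q : ModuleCat.{u} R, Module.Finite R Q → ExtMapZero f (n + 1) Q) :
    (tensorHomology P (n + 1)).map f = 0 := by
  induction n generalizing A B with
  | zero =>
    obtain ⟨b, p, hp⟩ := Module.Finite.exists_fin' R B
    have hB := LinearMap.shortExact_shortComplexKer hp
    obtain ⟨x, hx⟩ := Abelian.Ext.covariant_sequence_exact₃ A hB (Abelian.Ext.mk₀ f)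
      (zero_add 1) (hf (ModuleCat.of R (LinearMap.ker p)) inferInstance hB.extClass)
    obtain ⟨g, rfl⟩ := (Abelian.Ext.mk₀_bijective _ _).2 x
    have hg : g ≫ p.shortComplexKer.g = f :=
      (Abelian.Ext.mk₀_bijective _ _).1 ((Abelian.Ext.mk₀_comp_mk₀ _ _).symm.trans hx)
    rw [← hg, Functor.map_comp]
    exact (isZero_tensorHomology_of_flat hP (ModuleCat.of R (Fin b → R)) 0).eq_zero_of_tgt
      _ =≫ _ |>.trans Limits.zero_comp
  | succ n ih =>
    obtain ⟨a, q, hq⟩ := Module.Finite.exists_fin' R A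
    obtain ⟨b, p, hp⟩ := Module.Finite.exists_fin' R B
    have hA := LinearMap.shortExact_shortComplexKer hq
    have hB := LinearMap.shortExact_shortComplexKer hp
    obtain ⟨l, hl⟩ := Module.projective_lifting_property p (f.hom ∘ₗ q) hp
    have hl' (v) : p (l v) = f (q v) := LinearMap.congr_fun hl v
    let φ : q.shortComplexKer ⟶ p.shortComplexKer :=
      { τ₁ := ModuleCat.ofHom (l.restrict fun v hv ↦ by
          rw [LinearMap.mem_ker] at hv ⊢; rw [hl', hv, map_zero])
        τ₂ := ModuleCat.ofHom l
        τ₃ := f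
        comm₁₂ := rfl
        comm₂₃ := ModuleCat.hom_ext hl }
    have hφ (Q : ModuleCat.{u} R) (hQ : Module.Finite R Q) : ExtMapZero φ.τ₁ (n + 1) Q := by
      intro x
      have h0 : hA.extClass.comp ((Abelian.Ext.mk₀ φ.τ₁).comp x (zero_add _))
          (add_comm 1 (n + 1)) = 0 := by
        rw [← mk₀_τ₃_comp_extClass_comp hA hB φ]
        exact hf Q hQ _
      obtain ⟨y, hy⟩ := Abelian.Ext.contravariant_sequence_exact₁ hA Q _ _ h0
      have : Projective q.shortComplexKer.X₂ :=
        inferInstanceAs (Projective (ModuleCat.of R (Fin a → R)))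
      rw [← hy, Abelian.Ext.eq_zero_of_projective (P := q.shortComplexKer.X₂) y,
        Abelian.Ext.comp_zero]
    have h1 := ih φ.τ₁ hφ
    have h2 := HomologicalComplex.HomologySequence.δ_naturality
      ((tensorComplex P).mapShortComplex.map φ) (shortExact_map_tensorComplex hA)
      (shortExact_map_tensorComplex hB) (n + 2) (n + 1) rfl
    have : Mono ((shortExact_map_tensorComplex (P := P) hB).δ (n + 2) (n + 1) rfl) :=
      ((shortExact_map_tensorComplex (P := P) hB).homology_exact₃ (n + 2) (n + 1) rfl).mono_g
        ((isZero_tensorHomology_of_flat hP (ModuleCat.of R (Fin b → R)) (n + 1)).eq_zero_of_src _)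
    refine (cancel_mono ((shortExact_map_tensorComplex hB).δ (n + 2) (n + 1) rfl)).1 ?_
    exact h2.symm.trans ((_ ≫= h1).trans (Limits.comp_zero.trans Limits.zero_comp.symm))

lemma finite_of_exact [IsNoetherianRing R] {S : ShortComplex (ModuleCat.{u} R)} (hS : S.Exact)
    (h₁ : Module.Finite R S.X₁) (h₃ : Module.Finite R S.X₃) : Module.Finite R S.X₂ := by
  have hker : LinearMap.ker S.g.hom = LinearMap.range S.f.hom :=
    (LinearMap.exact_iff.1 ((ShortComplex.ShortExact.moduleCat_exact_iff_function_exact S).1 hS))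
  refine ⟨Submodule.fg_of_fg_map_of_fg_inf_ker S.g.hom ?_ ?_⟩
  · exact IsNoetherian.noetherian _
  · rw [top_inf_eq, hker, LinearMap.range_eq_map]
    exact Module.Finite.fg_top.map _

section Finiteness

variable [IsNoetherianRing R] [∀ n, Module.Flat R (P.X n)] {S : ShortComplex (ModuleCat.{u} R)}
  (hS : S.ShortExact)

include hS

lemma finite_tensorHomology_X₂ {n : ℕ} (h₁ : Module.Finite R ((tensorHomology P n).obj S.X₁))
    (h₃ : Module.Finite R ((tensorHomology P n).obj S.X₃)) :
    Module.Finite R ((tensorHomology P n).obj S.X₂) :=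
  finite_of_exact ((shortExact_map_tensorComplex (P := P) hS).homology_exact₂ n) h₁ h₃

lemma finite_tensorHomology_X₃ {n : ℕ} (h₂ : Module.Finite R ((tensorHomology P n).obj S.X₂))
    (h₁ : ∀ m, m + 1 = n → Module.Finite R ((tensorHomology P m).obj S.X₁)) :
    Module.Finite R ((tensorHomology P n).obj S.X₃) := by
  obtain _ | n := n
  · have : Epi ((tensorHomology P 0).map S.g) :=
      have := (shortExact_map_tensorComplex (P := P) hS).epi_g
      HomologicalComplex.epi_homologyMap_of_epi_of_not_rel (S.map (tensorComplex P)).g 0 (by simp)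
    exact .of_surjective ((tensorHomology P 0).map S.g).hom
      ((ModuleCat.epi_iff_surjective _).1 this)
  · exact finite_of_exact ((shortExact_map_tensorComplex (P := P) hS).homology_exact₃ (n + 1) n rfl)
      h₂ (h₁ n rfl)

lemma finite_tensorHomology_X₃_of_map_eq_zero {n : ℕ}
    (h₀ : (tensorHomology P (n + 1)).map S.g = 0)
    (h₁ : Module.Finite R ((tensorHomology P n).obj S.X₁)) :
    Module.Finite R ((tensorHomology P (n + 1)).obj S.X₃) := by
  have hmono : Mono ((shortExact_map_tensorComplex (P := P) hS).δ (n + 1) n rfl) :=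
    ((shortExact_map_tensorComplex (P := P) hS).homology_exact₃ (n + 1) n rfl).mono_g h₀
  have : IsNoetherian R ((S.map (tensorComplex P)).X₁.homology n) :=
    isNoetherian_of_isNoetherianRing_of_finite R ((tensorHomology P n).obj S.X₁)
  exact .of_injective ((shortExact_map_tensorComplex (P := P) hS).δ (n + 1) n rfl).hom
    ((ModuleCat.mono_iff_injective _).1 hmono)

end Finiteness

end TensorHomology

section Main

variable {R : Type u} [CommRing R] [IsNoetherianRing R] {P : ChainComplex (ModuleCat.{u} R) ℕ}

omit [IsNoetherianRing R] in
lemma support_quotient_eq_zeroLocus (I : Ideal R) :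
    Module.support R (R ⧸ I) = PrimeSpectrum.zeroLocus I := by
  rw [Module.support_eq_zeroLocus, Ideal.annihilator_quotient]

/-- Dévissage: finiteness of `Tor_n(N, M)` for finite `N` supported in `V(a)` follows from the
case `N = R ⧸ a` and finiteness in the previous degree. -/
lemma finite_tensorHomology_of_quotient [∀ n, Module.Flat R (P.X n)] {a : Ideal R} {n : ℕ}
    (hn : Module.Finite R ((tensorHomology P n).obj (ModuleCat.of R (R ⧸ a))))
    (ih : ∀ m, m + 1 = n → ∀ (N : Type u) [AddCommGroup N] [Module R N] [Module.Finite R N],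
      Module.support R N ⊆ PrimeSpectrum.zeroLocus (a : Set R) →
      Module.Finite R ((tensorHomology P m).obj (ModuleCat.of R N)))
    (N : Type u) [AddCommGroup N] [Module R N] [hN : Module.Finite R N] :
    Module.support R N ⊆ PrimeSpectrum.zeroLocus (a : Set R) →
      Module.Finite R ((tensorHomology P n).obj (ModuleCat.of R N)) := by
  induction hN using IsNoetherianRing.induction_on_isQuotientEquivQuotientPrime R with
  | subsingleton N =>
    intro _
    have h0 : Limits.IsZero ((tensorHomology P n).obj (ModuleCat.of R N)) :=
      Functor.map_isZero _ (ModuleCat.isZero_of_subsingleton _)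
    have := ModuleCat.subsingleton_of_isZero h0
    infer_instance
  | quotient N p e =>
    intro h
    have hp : a ≤ p.asIdeal := by
      have hmem : p ∈ Module.support R N := by
        rw [e.support_eq, support_quotient_eq_zeroLocus]
        exact le_refl (p.asIdeal : Set R)
      exact h hmem
    have hsurj : Function.Surjective (Submodule.mapQ a p.asIdeal LinearMap.id hp) := fun v ↦ by
      obtain ⟨r, rfl⟩ := Submodule.Quotient.mk_surjective _ v
      exact ⟨Submodule.Quotient.mk r, rfl⟩
    have hS := LinearMap.shortExact_shortComplexKer hsurj
    have h3 := finite_tensorHomology_X₃ hS hn fun m hm ↦ ih m hm _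
      ((Module.support_subset_of_injective (Submodule.subtype _)
        (Submodule.subtype_injective _)).trans (support_quotient_eq_zeroLocus a).subset)
    exact .equiv ((tensorHomology P n).mapIso e.symm.toModuleIso).toLinearEquiv
  | exact N₁ N₂ N₃ f g hf hg hfg h₁ h₃ =>
    intro h
    rw [Module.support_of_exact hfg hf hg, Set.union_subset_iff] at h
    have hS : (ShortComplex.mk (ModuleCat.ofHom f) (ModuleCat.ofHom g)
        (ModuleCat.hom_ext hfg.linearMap_comp_eq_zero)).ShortExact :=
      ModuleCat.shortComplex_shortExact _ hfg hf hg
    exact finite_tensorHomology_X₂ hS (h₁ h.1) (h₃ h.2)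

lemma finite_tensorHomology [∀ n, Module.Flat R (P.X n)] (hP : ∀ n, P.ExactAt (n + 1))
    (a : Ideal R) (h : ∀ i : ℕ,
      i ≤ sSup {i : ℕ | Nontrivial ((localCohomology a i).obj (ModuleCat.of R R))} →
      Module.Finite R ((tensorHomology P i).obj (ModuleCat.of R (R ⧸ a)))) (n : ℕ) :
    ∀ (N : Type u) [AddCommGroup N] [Module R N] [Module.Finite R N],
      Module.support R N ⊆ PrimeSpectrum.zeroLocus (a : Set R) →
      Module.Finite R ((tensorHomology P n).obj (ModuleCat.of R N)) := by
  induction n with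
  | zero =>
    exact fun N _ _ _ ↦ finite_tensorHomology_of_quotient (h 0 (Nat.zero_le _))
      (fun m hm ↦ absurd hm m.succ_ne_zero) N
  | succ n ih =>
    refine fun N _ _ _ ↦ finite_tensorHomology_of_quotient ?_ (fun m hm ↦ ?_) N
    · by_cases hn : n + 1 ≤ sSup {i : ℕ | Nontrivial ((localCohomology a i).obj (ModuleCat.of R R))}
      · exact h _ hn
      obtain ⟨s, hs, H⟩ := exists_extMapZero_of_sSup_lt a (not_le.1 hn) 1
      have hle : a ^ s ≤ a := Ideal.pow_le_self (by lia)
      have hsurj : Function.Surjective (Submodule.mapQ (a ^ s) a LinearMap.id hle) := fun v ↦ by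
        obtain ⟨r, rfl⟩ := Submodule.Quotient.mk_surjective _ v
        exact ⟨Submodule.Quotient.mk r, rfl⟩
      have hS := LinearMap.shortExact_shortComplexKer hsurj
      refine finite_tensorHomology_X₃_of_map_eq_zero hS ?_ (ih _ ?_)
      · refine tensorHomology_map_eq_zero hP n (quotientProj hle) fun Q hQ ↦ ?_
        have := (H Q hQ).comp_right (quotientProj (pow_one a).le)
        rwa [quotientProj_comp] at this
      · refine (Module.support_subset_of_injective (Submodule.subtype _)
          (Submodule.subtype_injective _)).trans ?_
        rw [support_quotient_eq_zeroLocus, PrimeSpectrum.zeroLocus_pow a (by lia)]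
    · obtain rfl : m = n := by lia
      exact ih

end Main

/-- If `c = cd(a, R)` and `Tor_i(R/a, M)` is finitely generated for every `0 ≤ i ≤ c`,
then `Tor_i(N, M)` is finitely generated for every finitely generated module `N` with
`Supp N ⊆ V(a)` and every `i ≥ 0`. -/
theorem tor_finite_of_tor_quotient_finite_up_to_cd
    {R : Type u} [CommRing R] [IsNoetherianRing R] (a : Ideal R)
    (M : Type u) [AddCommGroup M] [Module R M]
    (c : ℕ)
    (hc : c = sSup {i : ℕ | Nontrivial ((localCohomology a i).obj (ModuleCat.of R R))})
    (h : ∀ i : ℕ, i ≤ c → Module.Finite R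
      (((Tor (ModuleCat.{u} R) i).obj (ModuleCat.of R (R ⧸ a))).obj (ModuleCat.of R M)))
    (N : Type u) [AddCommGroup N] [Module R N] [Module.Finite R N]
    (hN : Module.support R N ⊆ PrimeSpectrum.zeroLocus (a : Set R)) (i : ℕ) :
    Module.Finite R
      (((Tor (ModuleCat.{u} R) i).obj (ModuleCat.of R N)).obj (ModuleCat.of R M)) := by
  subst hc
  let P := projectiveResolution (ModuleCat.of R M)
  have (n : ℕ) : Module.Flat R (P.complex.X n) :=
    have := (IsProjective.iff_projective (R := R) (P.complex.X n)).2 (P.projective n)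
    inferInstance
  have e (L : ModuleCat.{u} R) (n : ℕ) :
      ((Tor (ModuleCat.{u} R) n).obj L).obj (ModuleCat.of R M) ≅
        (tensorHomology P.complex n).obj L :=
    P.isoLeftDerivedObj ((MonoidalCategory.tensoringLeft (ModuleCat.{u} R)).obj L) n
  have := finite_tensorHomology P.complex_exactAt_succ a
    (fun n hn ↦ have := h n hn; .equiv (e _ n).toLinearEquiv) i N hN
  exact .equiv (e _ i).symm.toLinearEquiv
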